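/- arXiv:2602.23619 — 6 statements merged into one kernel-verified Lean document; each statement's English description precedes it below -/
import Mathlib

section
/- Let n ≥ 2 and let G be a transitive subgroup of the symmetric group on n letters (so G ≠ 1). Suppose G is semiconcentrated in proper abelian normal subgroups: there exist normal subgroups T₁, …, T_r of G, each abelian and each a proper subgroup of G, such that every g ∈ G with g ≠ 1 and ind(g) = a(G) lies in T_i for some i. Then either (a) G is nilpotent, or (b) there exists a proper normal subgroup N of G that is nilpotent and contains every g ∈ G with ind(g) = a(G). -/
/-- Malle's index of a permutation of `Fin n`: `n` minus the number of orbits of the cyclic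
subgroup generated by the permutation. -/
noncomputable def permInd {n : ℕ} (g : Equiv.Perm (Fin n)) : ℕ :=
  n - Nat.card (MulAction.orbitRel.Quotient (Subgroup.zpowers g) (Fin n))

/-- The minimal index `a(G)` of a permutation group `G`: the minimum of `permInd g`
over nonidentity `g ∈ G`. -/
noncomputable def minInd {n : ℕ} (G : Subgroup (Equiv.Perm (Fin n))) : ℕ :=
  sInf {m | ∃ g ∈ G, g ≠ 1 ∧ permInd g = m}

namespace Subgroup

variable {G : Type*} [Group G]

theorem commutator_le_iff_map_le_centralizer (H K N : Subgroup G) [N.Normal] :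
    ⁅H, K⁆ ≤ N ↔
      H.map (QuotientGroup.mk' N) ≤ centralizer (K.map (QuotientGroup.mk' N) : Subgroup (G ⧸ N)) := by
  rw [← commutator_eq_bot_iff_le_centralizer, ← map_commutator, map_eq_bot_iff,
    QuotientGroup.ker_mk']

theorem iSup_commutator_le {ι : Sort*} {H : ι → Subgroup G} {K N : Subgroup G} [N.Normal]
    (h : ∀ i, ⁅H i, K⁆ ≤ N) : ⁅⨆ i, H i, K⁆ ≤ N := by
  rw [commutator_le_iff_map_le_centralizer, map_iSup, iSup_le_iff]
  exact fun i ↦ (commutator_le_iff_map_le_centralizer _ _ _).1 (h i)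

theorem commutator_sup_le {H K L N : Subgroup G} [N.Normal]
    (hK : ⁅H, K⁆ ≤ N) (hL : ⁅H, L⁆ ≤ N) : ⁅H, K ⊔ L⁆ ≤ N := by
  rw [commutator_comm, commutator_le_iff_map_le_centralizer] at *
  rw [map_sup]
  exact sup_le hK hL

/-- The lower central series of a subgroup, shifted by one and preceded by the whole group. -/
def shiftedLowerCentralSeries (A : Subgroup G) : ℕ → Subgroup G
  | 0 => ⊤
  | n + 1 => A.lowerCentralSeries n

instance shiftedLowerCentralSeries_normal (A : Subgroup G) [A.Normal] (n : ℕ) :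
    (A.shiftedLowerCentralSeries n).Normal := by
  cases n <;> rw [shiftedLowerCentralSeries] <;> infer_instance

theorem shiftedLowerCentralSeries_commutator_le (A : Subgroup G) [A.Normal] (n : ℕ) :
    ⁅A.shiftedLowerCentralSeries n, A⁆ ≤ A.shiftedLowerCentralSeries (n + 1) := by
  cases n with
  | zero => exact commutator_le_right _ _
  | succ n => exact le_rfl

theorem lowerCentralSeries_sup_le (A B : Subgroup G) [A.Normal] [B.Normal] (n : ℕ) :
    (A ⊔ B).lowerCentralSeries n ≤
      ⨆ p : {p : ℕ × ℕ // p.1 + p.2 = n + 1},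
        A.shiftedLowerCentralSeries p.1.1 ⊓ B.shiftedLowerCentralSeries p.1.2 := by
  induction n with
  | zero =>
    refine sup_le ?_ ?_
    · exact le_iSup_of_le ⟨(1, 0), rfl⟩ (le_inf le_rfl le_top)
    · exact le_iSup_of_le ⟨(0, 1), rfl⟩ (le_inf le_top le_rfl)
  | succ n ih =>
    refine (commutator_mono ih le_rfl).trans (iSup_commutator_le ?_)
    rintro ⟨⟨i, j⟩, hij⟩
    refine commutator_sup_le ?_ ?_
    · refine le_iSup_of_le ⟨(i + 1, j), by dsimp only at hij ⊢; omega⟩ (le_inf ?_ ?_)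
      · exact (commutator_mono inf_le_left le_rfl).trans
          (shiftedLowerCentralSeries_commutator_le A i)
      · exact (commutator_mono inf_le_right le_rfl).trans (commutator_le_left _ _)
    · refine le_iSup_of_le ⟨(i, j + 1), by dsimp only at hij ⊢; omega⟩ (le_inf ?_ ?_)
      · exact (commutator_mono inf_le_left le_rfl).trans (commutator_le_left _ _)
      · exact (commutator_mono inf_le_right le_rfl).trans
          (shiftedLowerCentralSeries_commutator_le B j)

/-- **Fitting's theorem**: the join of two nilpotent normal subgroups is nilpotent. -/
theorem isNilpotent_sup {A B : Subgroup G} [A.Normal] [B.Normal]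
    (hA : Group.IsNilpotent A) (hB : Group.IsNilpotent B) :
    Group.IsNilpotent (A ⊔ B : Subgroup G) := by
  rw [isNilpotent_iff_lowerCentralSeries] at *
  obtain ⟨a, ha⟩ := hA
  obtain ⟨b, hb⟩ := hB
  refine ⟨a + b + 1, eq_bot_iff.2 ((lowerCentralSeries_sup_le A B _).trans (iSup_le ?_))⟩
  rintro ⟨⟨i, j⟩, hij⟩
  dsimp only at hij ⊢
  obtain hi | hj : a + 1 ≤ i ∨ b + 1 ≤ j := by omega
  · obtain ⟨k, rfl⟩ := Nat.exists_eq_add_of_le' hi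
    exact inf_le_left.trans ((A.lowerCentralSeries_antitone (Nat.le_add_left a k)).trans ha.le)
  · obtain ⟨k, rfl⟩ := Nat.exists_eq_add_of_le' hj
    exact inf_le_right.trans ((B.lowerCentralSeries_antitone (Nat.le_add_left b k)).trans hb.le)

theorem normal_and_isNilpotent_finset_sup {ι : Type*} (s : Finset ι) (T : ι → Subgroup G)
    (hT : ∀ i ∈ s, (T i).Normal ∧ Group.IsNilpotent (T i)) :
    (s.sup T).Normal ∧ Group.IsNilpotent (s.sup T : Subgroup G) := by
  refine Finset.sup_induction (p := fun A : Subgroup G ↦ A.Normal ∧ Group.IsNilpotent A)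
    ⟨inferInstance, inferInstance⟩ ?_ hT
  rintro A ⟨_, hA⟩ B ⟨_, hB⟩
  exact ⟨inferInstance, isNilpotent_sup hA hB⟩

end Subgroup

/-- If a transitive permutation group `G` of degree `n ≥ 2` is semiconcentrated in proper
abelian normal subgroups `T₁, …, T_r`, then either `G` is nilpotent, or `G` has a proper
nilpotent normal subgroup containing all elements of minimal index. -/
theorem semiconcentrated_in_abelian (n : ℕ) (hn : 2 ≤ n)
    (G : Subgroup (Equiv.Perm (Fin n))) (hG : G ≠ ⊥)
    (htrans : ∀ x y : Fin n, ∃ g ∈ G, g x = y)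
    (r : ℕ) (T : Fin r → Subgroup G)
    (hnormal : ∀ i, (T i).Normal)
    (habelian : ∀ i, ∀ x ∈ T i, ∀ y ∈ T i, x * y = y * x)
    (hproper : ∀ i, T i ≠ ⊤)
    (hsemi : ∀ g : G, g ≠ 1 → permInd (g : Equiv.Perm (Fin n)) = minInd G → ∃ i, g ∈ T i) :
    Group.IsNilpotent G ∨
      ∃ N : Subgroup G, N.Normal ∧ N ≠ ⊤ ∧ Group.IsNilpotent N ∧
        ∀ g : G, permInd (g : Equiv.Perm (Fin n)) = minInd G → g ∈ N := by
  have hT : ∀ i, (T i).Normal ∧ Group.IsNilpotent (T i) := fun i ↦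
    ⟨hnormal i, (T i).isNilpotent_iff_lowerCentralSeries.2 ⟨1,
      Subgroup.commutator_eq_bot_iff_le_centralizer.2 fun x hx y hy ↦ habelian i y hy x hx⟩⟩
  obtain ⟨hN, hnil⟩ := Subgroup.normal_and_isNilpotent_finset_sup Finset.univ T fun i _ ↦ hT i
  by_cases htop : Finset.univ.sup T = ⊤
  · left
    rw [htop] at hnil
    exact Group.isNilpotent_top.1 hnil
  · refine .inr ⟨Finset.univ.sup T, hN, htop, hnil, fun g hg ↦ ?_⟩
    by_cases h1 : g = 1
    · exact h1 ▸ one_mem _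
    · obtain ⟨i, hi⟩ := hsemi g h1 hg
      exact Finset.le_sup (f := T) (Finset.mem_univ i) hi
end

section
/- Let n ≥ 1, let U ⊆ ℝⁿ be open and connected, let μ ≥ 0, and let f be a holomorphic function on the tube over the convex hull of U in ℂⁿ. Suppose that for every compact set Q ⊆ U there is a constant C_Q such that |f(σ + it)| ≤ C_Q·(1 + ‖t‖)^μ for all σ ∈ Q and all t ∈ ℝⁿ. Then for every compact set Q′ ⊆ convexHull(U) there is a constant C′ such that |f(σ + it)| ≤ C′·(1 + ‖t‖)^μ for all σ ∈ Q′ and all t ∈ ℝⁿ. -/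
/-- The Euclidean norm on `ℝⁿ` (presented as `Fin n → ℝ`). -/
noncomputable def euclNorm {n : ℕ} (t : Fin n → ℝ) : ℝ :=
  Real.sqrt (∑ i, t i ^ 2)

theorem euclNorm_eq_norm {n : ℕ} (t : Fin n → ℝ) : euclNorm t = ‖WithLp.toLp 2 t‖ := by
  simp [euclNorm, EuclideanSpace.norm_eq]

theorem euclNorm_nonneg {n : ℕ} (t : Fin n → ℝ) : 0 ≤ euclNorm t := Real.sqrt_nonneg _

theorem euclNorm_add_le {n : ℕ} (s t : Fin n → ℝ) :
    euclNorm (s + t) ≤ euclNorm s + euclNorm t := by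
  simpa only [euclNorm_eq_norm, WithLp.toLp_add] using norm_add_le _ _

theorem euclNorm_smul {n : ℕ} (c : ℝ) (t : Fin n → ℝ) :
    euclNorm (c • t) = |c| * euclNorm t := by
  simp only [euclNorm_eq_norm, WithLp.toLp_smul, norm_smul, Real.norm_eq_abs]

/-- Translating by a vector of norm at most `B` changes `(1 + ‖t‖) ^ μ` by a bounded factor. -/
theorem one_add_euclNorm_add_rpow_le {n : ℕ} {μ B : ℝ} (hμ : 0 ≤ μ) (s t : Fin n → ℝ)
    (hs : euclNorm s ≤ B) :
    (1 + euclNorm (t + s)) ^ μ ≤ (1 + B) ^ μ * (1 + euclNorm t) ^ μ := by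
  have ht := euclNorm_nonneg t
  have hs' := euclNorm_nonneg s
  have hts := euclNorm_nonneg (t + s)
  rw [← Real.mul_rpow (by linarith) (by linarith)]
  refine Real.rpow_le_rpow (by linarith) ?_ hμ
  nlinarith [euclNorm_add_le t s]

/-- A maximum principle on parabolic analytic discs: a function holomorphic on the tube over the
standard triangle is bounded at an interior point by its supremum over a bounded part of the tube
over the two legs of the triangle. -/
theorem exists_norm_le_of_forall_legs {α β : ℝ} (hα : 0 < α) (hβ : 0 < β) (hαβ : α + β < 1) :
    ∃ B : ℝ, ∀ (g : ℂ × ℂ → ℂ) (M : ℝ),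
      (∀ z : ℂ × ℂ, 0 ≤ z.1.re → 0 ≤ z.2.re → z.1.re + z.2.re ≤ 1 → DifferentiableAt ℂ g z) →
      (∀ z : ℂ × ℂ, |z.1.im| ≤ B → |z.2.im| ≤ B →
        (z.1.re = 0 ∧ z.2.re ∈ Set.Icc 0 1 ∨ z.2.re = 0 ∧ z.1.re ∈ Set.Icc 0 1) → ‖g z‖ ≤ M) →
      ‖g ((α : ℂ), (β : ℂ))‖ ≤ M := by
  obtain ⟨ε, hε, hε'⟩ : ∃ ε : ℝ, 0 < ε ∧ α + β + ε < 1 :=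
    ⟨(1 - α - β) / 2, by linarith, by linarith⟩
  refine ⟨3 * (3 / ε + 1), fun g M hg hM => ?_⟩
  let φ : ℂ → ℂ × ℂ := fun w => (w + α, -w + β + ε * w ^ 2)
  have hφ : Differentiable ℂ φ := by fun_prop
  have hre1 (w : ℂ) : (φ w).1.re = w.re + α := by simp [φ]
  have him1 (w : ℂ) : (φ w).1.im = w.im := by simp [φ]
  have hre2 (w : ℂ) : (φ w).2.re = -w.re + β + ε * (w.re ^ 2 - w.im ^ 2) := by
    simp [φ, pow_two]
  have him2 (w : ℂ) : (φ w).2.im = -w.im + 2 * ε * (w.re * w.im) := by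
    simp [φ, pow_two]; ring
  let D : Set ℂ := {w | 0 < w.re + α ∧ w.re + α < 1 ∧
    0 < -w.re + β + ε * (w.re ^ 2 - w.im ^ 2)}
  let K : Set ℂ := {w | 0 ≤ w.re + α ∧ w.re + α ≤ 1 ∧
    0 ≤ -w.re + β + ε * (w.re ^ 2 - w.im ^ 2)}
  have hc1 : Continuous fun w : ℂ => w.re + α := by fun_prop
  have hc2 : Continuous fun w : ℂ => -w.re + β + ε * (w.re ^ 2 - w.im ^ 2) := by fun_prop
  have hDo : IsOpen D :=
    (isOpen_lt continuous_const hc1).inter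
      ((isOpen_lt hc1 continuous_const).inter (isOpen_lt continuous_const hc2))
  have hKc : IsClosed K :=
    (isClosed_le continuous_const hc1).inter
      ((isClosed_le hc1 continuous_const).inter (isClosed_le continuous_const hc2))
  have hcl : closure D ⊆ K :=
    closure_minimal (fun w hw => ⟨hw.1.le, hw.2.1.le, hw.2.2.le⟩) hKc
  have hx (w : ℂ) (hw : w ∈ K) : w.re ^ 2 ≤ 1 := by
    obtain ⟨h1, h2, -⟩ := hw
    nlinarith
  have hy (w : ℂ) (hw : w ∈ K) : |w.im| ≤ 3 / ε + 1 := by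
    have hx' := hx w hw
    obtain ⟨h1, h2, h3⟩ := hw
    have : w.im ^ 2 ≤ 3 / ε := by
      rw [le_div_iff₀ hε]
      nlinarith
    rw [← sq_abs] at this
    nlinarith [sq_nonneg (|w.im| - 1), abs_nonneg w.im]
  have hdiff (w : ℂ) (hw : w ∈ K) : DifferentiableAt ℂ (g ∘ φ) w := by
    have hx' := hx w hw
    refine (hg (φ w) ?_ ?_ ?_).comp w (hφ w)
    · rw [hre1]; exact hw.1
    · rw [hre2]; exact hw.2.2
    · rw [hre1, hre2]
      nlinarith [mul_nonneg hε.le (sq_nonneg w.im)]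
  have hbdd : Bornology.IsBounded D := by
    refine (Metric.isBounded_closedBall (x := (0 : ℂ)) (r := 1 + (3 / ε + 1))).subset fun w hw => ?_
    rw [mem_closedBall_zero_iff]
    have hwK := hcl (subset_closure hw)
    refine (Complex.norm_le_abs_re_add_abs_im w).trans (add_le_add ?_ (hy w hwK))
    exact (sq_le_one_iff_abs_le_one _).1 (hx w hwK)
  have h0 : (0 : ℂ) ∈ D := by
    refine ⟨by simpa using hα, ?_, by simpa using hβ⟩
    simp only [Complex.zero_re, zero_add]; linarith
  have hd : DiffContOnCl ℂ (g ∘ φ) D :=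
    ⟨fun w hw => (hdiff w (hcl (subset_closure hw))).differentiableWithinAt,
      fun w hw => (hdiff w (hcl hw)).continuousAt.continuousWithinAt⟩
  have key := Complex.norm_le_of_forall_mem_frontier_norm_le hbdd hd (C := M) ?_
    (subset_closure h0)
  · simpa [φ] using key
  intro w hw
  rw [hDo.frontier_eq] at hw
  have hwK := hcl hw.1
  have hx' := hx w hwK
  have hy' := hy w hwK
  have hxa := (sq_le_one_iff_abs_le_one _).1 hx'
  obtain ⟨h1, h2, h3⟩ := id hwK
  have hey : 0 ≤ ε * w.im ^ 2 := by positivity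
  refine hM (φ w) ?_ ?_ ?_
  · rw [him1]
    linarith [abs_nonneg w.im]
  · rw [him2]
    have e1 : |2 * ε * (w.re * w.im)| = 2 * ε * (|w.re| * |w.im|) := by
      rw [abs_mul, abs_mul w.re, abs_of_pos (by positivity : (0 : ℝ) < 2 * ε)]
    have e2 : |w.re| * |w.im| ≤ 1 * |w.im| := by gcongr
    have e3 := abs_add_le (-w.im) (2 * ε * (w.re * w.im))
    rw [abs_neg, e1] at e3
    have e4 := abs_nonneg w.im
    have e5 : 0 ≤ |w.re| * |w.im| := by positivity
    nlinarith
  · rw [hre1, hre2]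
    have hlt : w.re + α < 1 := by
      refine lt_of_le_of_ne h2 fun h => ?_
      nlinarith
    rcases h1.eq_or_lt with h | h
    · left
      refine ⟨h.symm, h3, ?_⟩
      nlinarith
    · right
      refine ⟨?_, h1, h2⟩
      by_contra hne
      exact hw.2 ⟨h, hlt, lt_of_le_of_ne h3 (Ne.symm hne)⟩

/-- The points of the convex hull of `U` around which `f` has uniform polynomial growth of order
`μ` in the imaginary directions. -/
def polyGrowthLocus {n : ℕ} (U : Set (Fin n → ℝ)) (μ : ℝ) (f : (Fin n → ℂ) → ℂ) :
    Set (Fin n → ℝ) :=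
  interior (convexHull ℝ U) ∩ {σ | ∃ C : ℝ, ∀ᶠ σ' in nhds σ, ∀ t : Fin n → ℝ,
    ‖f (fun i => (σ' i : ℂ) + (t i : ℂ) * Complex.I)‖ ≤ C * (1 + euclNorm t) ^ μ}

section

variable {n : ℕ} {U : Set (Fin n → ℝ)} {μ : ℝ} {f : (Fin n → ℂ) → ℂ}

theorem polyGrowthLocus_subset : polyGrowthLocus U μ f ⊆ convexHull ℝ U :=
  fun _ h => interior_subset h.1

theorem isOpen_polyGrowthLocus : IsOpen (polyGrowthLocus U μ f) := by
  refine isOpen_interior.inter (isOpen_iff_mem_nhds.2 ?_)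
  rintro σ ⟨C, hC⟩
  filter_upwards [eventually_eventually_nhds.2 hC] with σ' h using ⟨C, h⟩

theorem subset_polyGrowthLocus (hU : IsOpen U)
    (hbound : ∀ Q : Set (Fin n → ℝ), IsCompact Q → Q ⊆ U →
      ∃ C : ℝ, ∀ σ ∈ Q, ∀ t : Fin n → ℝ,
        ‖f (fun i => (σ i : ℂ) + (t i : ℂ) * Complex.I)‖ ≤ C * (1 + euclNorm t) ^ μ) :
    U ⊆ polyGrowthLocus U μ f := by
  intro σ hσ
  refine ⟨interior_mono (subset_convexHull ℝ U) (hU.interior_eq.symm ▸ hσ), ?_⟩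
  obtain ⟨Q, hQ, hσQ, hQU⟩ := exists_compact_subset hU hσ
  obtain ⟨C, hC⟩ := hbound Q hQ hQU
  exact ⟨C, by filter_upwards [mem_interior_iff_mem_nhds.1 hσQ] with σ' h using hC σ' h⟩

/-- Local polynomial bounds are uniform near a compact set. -/
theorem exists_thickening_bound {L : Set (Fin n → ℝ)} (hL : IsCompact L)
    (hLV : L ⊆ polyGrowthLocus U μ f) :
    ∃ C : ℝ, 0 ≤ C ∧ ∃ δ > 0, Metric.thickening δ L ⊆ convexHull ℝ U ∧
      ∀ σ ∈ Metric.thickening δ L, ∀ t : Fin n → ℝ,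
        ‖f (fun i => (σ i : ℂ) + (t i : ℂ) * Complex.I)‖ ≤ C * (1 + euclNorm t) ^ μ := by
  have main : ∃ C : ℝ, 0 ≤ C ∧ ∀ᶠ σ in nhdsSet L, σ ∈ convexHull ℝ U ∧ ∀ t : Fin n → ℝ,
      ‖f (fun i => (σ i : ℂ) + (t i : ℂ) * Complex.I)‖ ≤ C * (1 + euclNorm t) ^ μ := by
    have hnn (t : Fin n → ℝ) : 0 ≤ (1 + euclNorm t) ^ μ :=
      Real.rpow_nonneg (by linarith [euclNorm_nonneg t]) _
    refine hL.induction_on (p := fun L => ∃ C : ℝ, 0 ≤ C ∧ ∀ᶠ σ in nhdsSet L,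
      σ ∈ convexHull ℝ U ∧ ∀ t : Fin n → ℝ,
      ‖f (fun i => (σ i : ℂ) + (t i : ℂ) * Complex.I)‖ ≤ C * (1 + euclNorm t) ^ μ) ?_ ?_ ?_ ?_
    · exact ⟨0, le_rfl, by simp⟩
    · rintro s t hst ⟨C, hC0, hC⟩
      exact ⟨C, hC0, hC.filter_mono (nhdsSet_mono hst)⟩
    · rintro s t ⟨C, hC0, hC⟩ ⟨C', hC0', hC'⟩
      refine ⟨max C C', le_max_of_le_left hC0, ?_⟩
      rw [nhdsSet_union, Filter.eventually_sup]
      constructor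
      · filter_upwards [hC] with σ h
        exact ⟨h.1, fun t => (h.2 t).trans
          (mul_le_mul_of_nonneg_right (le_max_left _ _) (hnn t))⟩
      · filter_upwards [hC'] with σ h
        exact ⟨h.1, fun t => (h.2 t).trans
          (mul_le_mul_of_nonneg_right (le_max_right _ _) (hnn t))⟩
    · intro σ hσ
      obtain ⟨hσ1, C, hC⟩ := hLV hσ
      obtain ⟨s, hs, hso, hσs⟩ := eventually_nhds_iff.1
        (hC.and (mem_interior_iff_mem_nhds.1 hσ1))
      refine ⟨s, mem_nhdsWithin_of_mem_nhds (hso.mem_nhds hσs), max C 0, le_max_right _ _, ?_⟩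
      filter_upwards [hso.mem_nhdsSet_self] with σ' h
      exact ⟨(hs σ' h).2, fun t => ((hs σ' h).1 t).trans
        (mul_le_mul_of_nonneg_right (le_max_left _ _) (hnn t))⟩
  obtain ⟨C, hC0, hC⟩ := main
  obtain ⟨s, hso, hLs, hs⟩ := mem_nhdsSet_iff_exists.1 hC
  obtain ⟨δ, hδ, hδs⟩ := hL.exists_thickening_subset_open hso hLs
  exact ⟨C, hC0, δ, hδ, fun σ h => (hs (hδs h)).1, fun σ h => (hs (hδs h)).2⟩

/-- Points strictly inside a triangle whose two legs lie in the growth locus belong to it. -/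
theorem add_smul_add_smul_mem_of_lt (hμ : 0 ≤ μ) (hU : IsOpen U)
    (hf : DifferentiableOn ℂ f {s : Fin n → ℂ | (fun i => (s i).re) ∈ convexHull ℝ U})
    {p u v : Fin n → ℝ} (hu : ∀ x ∈ Set.Icc (0 : ℝ) 1, p + x • u ∈ polyGrowthLocus U μ f)
    (hv : ∀ x ∈ Set.Icc (0 : ℝ) 1, p + x • v ∈ polyGrowthLocus U μ f)
    {α β : ℝ} (hα : 0 < α) (hβ : 0 < β) (hαβ : α + β < 1) :
    p + α • u + β • v ∈ polyGrowthLocus U μ f := by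
  have hHo : IsOpen (convexHull ℝ U) := hU.convexHull
  have hHc : Convex ℝ (convexHull ℝ U) := convex_convexHull ℝ U
  have htube : IsOpen {s : Fin n → ℂ | (fun i => (s i).re) ∈ convexHull ℝ U} :=
    hHo.preimage (by fun_prop)
  have comb {q : Fin n → ℝ} (h0 : q ∈ convexHull ℝ U) (h1 : q + u ∈ convexHull ℝ U)
      (h2 : q + v ∈ convexHull ℝ U) {x y : ℝ} (hx : 0 ≤ x) (hy : 0 ≤ y) (hxy : x + y ≤ 1) :
      q + x • u + y • v ∈ convexHull ℝ U := by
    have := hHc.sum_mem (t := Finset.univ) (w := ![1 - x - y, x, y]) (z := ![q, q + u, q + v])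
      (by intro i _; fin_cases i <;> simp <;> linarith)
      (by simp [Fin.sum_univ_three]; ring)
      (by intro i _; fin_cases i <;> simp [h0, h1, h2])
    convert this using 1
    simp only [Fin.sum_univ_three, Matrix.cons_val]
    module
  let L : Set (Fin n → ℝ) :=
    (fun x : ℝ => p + x • u) '' Set.Icc 0 1 ∪ (fun x : ℝ => p + x • v) '' Set.Icc 0 1
  have hL : IsCompact L :=
    (isCompact_Icc.image (by fun_prop)).union (isCompact_Icc.image (by fun_prop))
  have hLV : L ⊆ polyGrowthLocus U μ f := by
    rintro _ (⟨x, hx, rfl⟩ | ⟨x, hx, rfl⟩)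
    exacts [hu x hx, hv x hx]
  obtain ⟨C, hC0, δ, hδ, hδH, hbd⟩ := exists_thickening_bound hL hLV
  obtain ⟨B, hB⟩ := exists_norm_le_of_forall_legs hα hβ hαβ
  have hp : p ∈ convexHull ℝ U := by
    simpa using polyGrowthLocus_subset (hu 0 (by simp))
  have hpu : p + u ∈ convexHull ℝ U := by
    simpa using polyGrowthLocus_subset (hu 1 (by simp))
  have hpv : p + v ∈ convexHull ℝ U := by
    simpa using polyGrowthLocus_subset (hv 1 (by simp))
  refine ⟨?_, C * (1 + (B * euclNorm u + B * euclNorm v)) ^ μ, ?_⟩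
  · have := comb hp hpu hpv hα.le hβ.le hαβ.le
    rwa [← hHo.interior_eq] at this
  filter_upwards [Metric.ball_mem_nhds _ hδ] with σ hσ T
  obtain ⟨q, rfl⟩ : ∃ q, σ = q + α • u + β • v := ⟨σ - α • u - β • v, by abel⟩
  have hq : dist q p < δ := by
    simpa [Metric.mem_ball, dist_eq_norm, add_assoc] using hσ
  have hthick {y : Fin n → ℝ} (h : p + y ∈ L) : q + y ∈ Metric.thickening δ L :=
    Metric.mem_thickening_iff.2 ⟨p + y, h, by simpa using hq⟩
  have hLu {x : ℝ} (hx : x ∈ Set.Icc (0 : ℝ) 1) : p + x • u ∈ L := Or.inl ⟨x, hx, rfl⟩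
  have hLv {x : ℝ} (hx : x ∈ Set.Icc (0 : ℝ) 1) : p + x • v ∈ L := Or.inr ⟨x, hx, rfl⟩
  have hq0 : q ∈ convexHull ℝ U := by
    simpa using hδH (hthick (hLu (x := 0) (by simp)))
  have hqu : q + u ∈ convexHull ℝ U := by
    simpa using hδH (hthick (hLu (x := 1) (by simp)))
  have hqv : q + v ∈ convexHull ℝ U := by
    simpa using hδH (hthick (hLv (x := 1) (by simp)))
  let ψ : ℂ × ℂ → Fin n → ℂ := fun z i => q i + z.1 * u i + z.2 * v i + T i * Complex.I
  have hψ : Differentiable ℂ ψ := by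
    rw [differentiable_pi]; intro i; fun_prop
  have hψre (z : ℂ × ℂ) : (fun i => (ψ z i).re) = q + z.1.re • u + z.2.re • v := by
    ext i; simp [ψ]
  have hψeq (z : ℂ × ℂ) : ψ z = fun i => (((q + z.1.re • u + z.2.re • v) i : ℝ) : ℂ) +
      (((T + (z.1.im • u + z.2.im • v)) i : ℝ) : ℂ) * Complex.I := by
    ext i
    apply Complex.ext <;> simp [ψ]
    ring
  have key := hB (f ∘ ψ) (C * (1 + (B * euclNorm u + B * euclNorm v)) ^ μ * (1 + euclNorm T) ^ μ)
    ?_ ?_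
  · convert key using 2
    simp only [Function.comp, hψeq]
    simp
  · intro z h1 h2 h3
    refine (hf.differentiableAt (htube.mem_nhds ?_)).comp z (hψ z)
    rw [Set.mem_ofPred_eq, hψre]
    exact comb hq0 hqu hqv h1 h2 h3
  · intro z h1 h2 h3
    have hmem : q + z.1.re • u + z.2.re • v ∈ Metric.thickening δ L := by
      rcases h3 with ⟨h, h'⟩ | ⟨h, h'⟩
      · simpa [h] using hthick (hLv h')
      · simpa [h] using hthick (hLu h')
    have hIm : euclNorm (z.1.im • u + z.2.im • v) ≤ B * euclNorm u + B * euclNorm v := by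
      refine (euclNorm_add_le _ _).trans ?_
      rw [euclNorm_smul, euclNorm_smul]
      gcongr <;> exact euclNorm_nonneg _
    rw [Function.comp, hψeq, mul_assoc]
    exact (hbd _ hmem _).trans
      (mul_le_mul_of_nonneg_left (one_add_euclNorm_add_rpow_le hμ _ _ hIm) hC0)

/-- A triangle whose two legs lie in the growth locus is contained in it. -/
theorem add_smul_add_smul_mem (hμ : 0 ≤ μ) (hU : IsOpen U)
    (hf : DifferentiableOn ℂ f {s : Fin n → ℂ | (fun i => (s i).re) ∈ convexHull ℝ U})
    {p u v : Fin n → ℝ} (hu : ∀ x ∈ Set.Icc (0 : ℝ) 1, p + x • u ∈ polyGrowthLocus U μ f)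
    (hv : ∀ x ∈ Set.Icc (0 : ℝ) 1, p + x • v ∈ polyGrowthLocus U μ f)
    {α β : ℝ} (hα : 0 ≤ α) (hβ : 0 ≤ β) (hαβ : α + β ≤ 1) :
    p + α • u + β • v ∈ polyGrowthLocus U μ f := by
  rcases hα.eq_or_lt with rfl | hα
  · simpa using hv β ⟨hβ, by linarith⟩
  rcases hβ.eq_or_lt with rfl | hβ
  · simpa using hu α ⟨hα.le, by linarith⟩
  have ext {w : Fin n → ℝ} (hw : ∀ x ∈ Set.Icc (0 : ℝ) 1, p + x • w ∈ polyGrowthLocus U μ f) :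
      ∀ᶠ x : ℝ in nhds 1, p + x • w ∈ polyGrowthLocus U μ f :=
    (by fun_prop : Continuous fun x : ℝ => p + x • w).continuousAt.eventually_mem
      (isOpen_polyGrowthLocus.mem_nhds (hw 1 (by simp)))
  obtain ⟨r, hr, hball⟩ := Metric.eventually_nhds_iff.1 ((ext hu).and (ext hv))
  set l : ℝ := 1 + r / 2 with hl
  have hl0 : 1 < l := by linarith
  have scale {w : Fin n → ℝ} (hw : ∀ x ∈ Set.Icc (0 : ℝ) 1, p + x • w ∈ polyGrowthLocus U μ f)
      (hw' : ∀ ⦃x : ℝ⦄, dist x 1 < r → p + x • w ∈ polyGrowthLocus U μ f) :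
      ∀ x ∈ Set.Icc (0 : ℝ) 1, p + x • l • w ∈ polyGrowthLocus U μ f := by
    intro x hx
    rw [smul_smul]
    rcases le_or_gt (x * l) 1 with h | h
    · exact hw _ ⟨mul_nonneg hx.1 (by linarith), h⟩
    · refine hw' ?_
      rw [Real.dist_eq, abs_of_pos (by linarith)]
      nlinarith [hx.2]
  have := add_smul_add_smul_mem_of_lt hμ hU hf (scale hu fun x h => (hball h).1)
    (scale hv fun x h => (hball h).2) (α := α / l) (β := β / l) (by positivity) (by positivity)
    (by rw [← add_div, div_lt_one (by linarith)]; linarith)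
  rwa [smul_smul, smul_smul, div_mul_cancel₀ _ (by positivity),
    div_mul_cancel₀ _ (by positivity)] at this

theorem convexHull_subset_polyGrowthLocus (hμ : 0 ≤ μ) (hU : IsOpen U) (hUc : IsConnected U)
    (hf : DifferentiableOn ℂ f {s : Fin n → ℂ | (fun i => (s i).re) ∈ convexHull ℝ U})
    (hUV : U ⊆ polyGrowthLocus U μ f) : convexHull ℝ U ⊆ polyGrowthLocus U μ f := by
  obtain ⟨p, hp⟩ := hUc.nonempty
  set V := polyGrowthLocus U μ f with hV
  have seg {a b : Fin n → ℝ} : segment ℝ a b ⊆ V ↔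
      ∀ x ∈ Set.Icc (0 : ℝ) 1, a + x • (b - a) ∈ V := by
    rw [segment_eq_image', Set.image_subset_iff]; rfl
  have tri {a b c : Fin n → ℝ} (hb : segment ℝ a b ⊆ V) (hc : segment ℝ a c ⊆ V) :
      segment ℝ b c ⊆ V := by
    rw [segment_eq_image_lineMap]
    rintro _ ⟨x, hx, rfl⟩
    have := add_smul_add_smul_mem hμ hU hf (seg.1 hb) (seg.1 hc) (sub_nonneg.2 hx.2) hx.1
      (by linarith)
    convert this using 1
    rw [AffineMap.lineMap_apply_module]
    module
  have hSconv : Convex ℝ {q | segment ℝ p q ⊆ V} := by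
    intro b hb c hc s t hs ht hst
    rw [Set.mem_ofPred_eq, seg]
    intro x hx
    have := add_smul_add_smul_mem hμ hU hf (seg.1 hb) (seg.1 hc)
      (mul_nonneg hx.1 hs) (mul_nonneg hx.1 ht) (by rw [← mul_add, hst, mul_one]; exact hx.2)
    convert this using 1
    obtain rfl : s = 1 - t := by linarith
    module
  have step {a b : Fin n → ℝ} (ha : segment ℝ p a ⊆ V) (hab : segment ℝ a b ⊆ V) :
      segment ℝ p b ⊆ V := tri (segment_symm ℝ p a ▸ ha) hab
  have hball {a : Fin n → ℝ} (ha : a ∈ U) : ∃ r > 0, ∀ b ∈ Metric.ball a r, segment ℝ a b ⊆ V := by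
    obtain ⟨r, hr, h⟩ := Metric.isOpen_iff.1 hU a ha
    exact ⟨r, hr, fun b hb => ((convex_ball a r).segment_subset (Metric.mem_ball_self hr) hb).trans
      (h.trans hUV)⟩
  have hUS : U ⊆ {q | segment ℝ p q ⊆ V} := by
    refine (hUc.isPreconnected.subset_of_closure_inter_subset
      (u := interior {q | segment ℝ p q ⊆ V}) isOpen_interior ?_ ?_).trans interior_subset
    · refine ⟨p, hp, mem_interior_iff_mem_nhds.2 ?_⟩
      obtain ⟨r, hr, h⟩ := hball hp
      exact Filter.mem_of_superset (Metric.ball_mem_nhds p hr) h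
    · rintro a ⟨hacl, haU⟩
      obtain ⟨r, hr, h⟩ := hball haU
      obtain ⟨b, hbS, hb⟩ := Metric.mem_closure_iff.1 (closure_mono interior_subset hacl) r hr
      have haS : segment ℝ p a ⊆ V :=
        step hbS (segment_symm ℝ a b ▸ h b (by rwa [Metric.mem_ball']))
      exact mem_interior_iff_mem_nhds.2
        (Filter.mem_of_superset (Metric.ball_mem_nhds a hr) fun c hc => step haS (h c hc))
  exact fun q hq => convexHull_min hUS hSconv hq (right_mem_segment ℝ p q)

end

/-- Multivariable Phragmén–Lindelöf for tube domains: if `f` is holomorphic on the tube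
over the convex hull of an open connected set `U ⊆ ℝⁿ` and satisfies a polynomial bound
`|f(σ + it)| ≤ C_Q (1 + ‖t‖)^μ` locally uniformly on the tube over `U`, then the same
bound (with a new constant) holds locally uniformly on the tube over the convex hull
of `U`. -/
theorem multivariable_phragmen_lindelof (n : ℕ) (hn : 1 ≤ n)
    (U : Set (Fin n → ℝ)) (hUopen : IsOpen U) (hUconn : IsConnected U)
    (μ : ℝ) (hμ : 0 ≤ μ) (f : (Fin n → ℂ) → ℂ)
    (hf : DifferentiableOn ℂ f {s : Fin n → ℂ | (fun i => (s i).re) ∈ convexHull ℝ U})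
    (hbound : ∀ Q : Set (Fin n → ℝ), IsCompact Q → Q ⊆ U →
      ∃ C : ℝ, ∀ σ ∈ Q, ∀ t : Fin n → ℝ,
        ‖f (fun i => (σ i : ℂ) + (t i : ℂ) * Complex.I)‖ ≤ C * (1 + euclNorm t) ^ μ) :
    ∀ Q' : Set (Fin n → ℝ), IsCompact Q' → Q' ⊆ convexHull ℝ U →
      ∃ C' : ℝ, ∀ σ ∈ Q', ∀ t : Fin n → ℝ,
        ‖f (fun i => (σ i : ℂ) + (t i : ℂ) * Complex.I)‖ ≤ C' * (1 + euclNorm t) ^ μ := by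
  intro Q hQ hQH
  obtain ⟨C, -, δ, hδ, -, hC⟩ := exists_thickening_bound hQ (hQH.trans
    (convexHull_subset_polyGrowthLocus hμ hUopen hUconn hf
      (subset_polyGrowthLocus hUopen hbound)))
  exact ⟨C, fun σ hσ => hC σ (Metric.self_subset_thickening hδ Q hσ)⟩
end

section
/- Let n ≥ 1 and 0 ≤ d ≤ n, let c ∈ ℝ^d, let W = {x ∈ ℝ^d : x_j > c_j for j = 1,…,d}, and let U′ ⊆ ℝ^{n−d} be open and connected. Let μ : ℝ^d → [0,∞) be continuous and non-increasing in each coordinate, and let f be a holomorphic function on the tube over W × convexHull(U′) in ℂⁿ. Suppose that for every ε > 0 and every compact set Q ⊆ W × U′ there is a constant C such that |f(σ + it)| ≤ C·(1 + ‖t‖)^{μ(σ₁,…,σ_d)+ε} for all σ ∈ Q and all t ∈ ℝⁿ. Then for every ε > 0 and every compact set Q′ ⊆ W × convexHull(U′) there is a constant C′ such that |f(σ + it)| ≤ C′·(1 + ‖t‖)^{μ(σ₁,…,σ_d)+ε} for all σ ∈ Q′ and all t ∈ ℝⁿ. -/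
/-- The Euclidean norm on `ℝ^d × ℝ^e`. -/
noncomputable def euclNorm2 {d e : ℕ} (t : (Fin d → ℝ) × (Fin e → ℝ)) : ℝ :=
  Real.sqrt (∑ j, t.1 j ^ 2 + ∑ i, t.2 i ^ 2)

/-- `x` is controlled by `K` at range `R` in the tube over `D`: every function holomorphic on the
tube over `D` is bounded at `x` by its bound on the points over `K` with imaginary part at most
`R`. -/
def TubeControlled {m : ℕ} (D K : Set (Fin m → ℝ)) (R : ℝ) (x : Fin m → ℝ) : Prop :=
  ∀ g : (Fin m → ℂ) → ℂ, DifferentiableOn ℂ g {z | (fun i => (z i).re) ∈ D} →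
    ∀ M : ℝ, (∀ x' ∈ K, ∀ y : Fin m → ℝ, ‖y‖ ≤ R →
      ‖g (fun i => (x' i : ℂ) + (y i : ℂ) * Complex.I)‖ ≤ M) →
    ‖g (fun i => (x i : ℂ))‖ ≤ M

theorem TubeControlled.mono {m : ℕ} {D K K' : Set (Fin m → ℝ)} {R R' : ℝ} {x : Fin m → ℝ}
    (h : TubeControlled D K R x) (hK : K ⊆ K') (hR : R ≤ R') : TubeControlled D K' R' x :=
  fun g hg M hM => h g hg M fun x' hx' y hy => hM x' (hK hx') y (hy.trans hR)

theorem TubeControlled.of_mem {m : ℕ} {D K : Set (Fin m → ℝ)} {R : ℝ} (hR : 0 ≤ R)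
    {x : Fin m → ℝ} (hx : x ∈ K) : TubeControlled D K R x := by
  intro g _ M hM
  simpa using hM x hx 0 (by simpa using hR)

/-- Holomorphy on a tube is invariant under imaginary translations. -/
theorem differentiableOn_tube_add_im {m : ℕ} {D : Set (Fin m → ℝ)} {g : (Fin m → ℂ) → ℂ}
    (hg : DifferentiableOn ℂ g {z | (fun i => (z i).re) ∈ D}) (y : Fin m → ℝ) :
    DifferentiableOn ℂ (fun z : Fin m → ℂ => g (fun i => z i + (y i : ℂ) * Complex.I))
      {z | (fun i => (z i).re) ∈ D} := by
  refine hg.comp (f := fun (z : Fin m → ℂ) i => z i + (y i : ℂ) * Complex.I) ?_ ?_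
  · refine Differentiable.differentiableOn ?_
    fun_prop
  · intro z hz
    simpa using hz

theorem TubeControlled.trans {m : ℕ} {D L K : Set (Fin m → ℝ)} {R₁ R₂ : ℝ} {x : Fin m → ℝ}
    (h₁ : TubeControlled D L R₁ x) (h₂ : ∀ x' ∈ L, TubeControlled D K R₂ x') :
    TubeControlled D K (R₁ + R₂) x := by
  intro g hg M hM
  refine h₁ g hg M fun x' hx' y hy => ?_
  refine h₂ x' hx' _ (differentiableOn_tube_add_im hg y) M fun x'' hx'' y' hy' => ?_
  have := hM x'' hx'' (y' + y) ((norm_add_le _ _).trans (by linarith))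
  simpa [add_mul, add_assoc] using this

/-- A triangle is controlled by two sides of a slightly larger triangle: apply the maximum
principle on the analytic curve `v = κ + e u²`, where `u`, `v` are the difference and the sum of
the two affine coordinates. -/
theorem tubeControlled_triangle {m : ℕ} {D : Set (Fin m → ℝ)} (b p q : Fin m → ℝ) {η : ℝ}
    (hη : 0 < η) (hη1 : η ≤ 1)
    (hD : ∀ s t : ℝ, 0 ≤ s → 0 ≤ t → s + t ≤ 1 + η → b + s • p + t • q ∈ D)
    {s t : ℝ} (hs : 0 ≤ s) (ht : 0 ≤ t) (hst : s + t ≤ 1) :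
    TubeControlled D
      ((fun r : ℝ => b + r • p) '' Set.Icc 0 (1 + η) ∪
        (fun r : ℝ => b + r • q) '' Set.Icc 0 (1 + η))
      (16 / η * (‖p‖ + ‖q‖)) (b + s • p + t • q) := by
  have hR : 0 ≤ 16 / η * (‖p‖ + ‖q‖) := by positivity
  rcases hs.eq_or_lt with rfl | hs'
  · exact .of_mem hR (Or.inr ⟨t, ⟨ht, by linarith⟩, by simp⟩)
  rcases ht.eq_or_lt with rfl | ht'
  · exact .of_mem hR (Or.inl ⟨s, ⟨hs, by linarith⟩, by simp⟩)
  intro g hg M hM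
  obtain ⟨e, he⟩ : ∃ e : ℝ, e = η / 8 := ⟨_, rfl⟩
  have he0 : 0 < e := by rw [he]; positivity
  obtain ⟨κ, hκ⟩ : ∃ κ : ℝ, κ = s + t - e * (s - t) ^ 2 := ⟨_, rfl⟩
  have hκ1 : κ ≤ 1 := by
    have : 0 ≤ e * (s - t) ^ 2 := by positivity
    linarith
  let v : ℂ → ℂ := fun w => (κ : ℂ) + (e : ℂ) * w ^ 2
  have v_re (w : ℂ) : (v w).re = κ + e * (w.re ^ 2 - w.im ^ 2) := by
    simp [v, pow_two]
  have v_im (w : ℂ) : (v w).im = 2 * e * w.re * w.im := by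
    simp [v, pow_two]; ring
  let γ : ℂ → Fin m → ℂ := fun w i =>
    (b i : ℂ) + (v w + w) / 2 * (p i : ℂ) + (v w - w) / 2 * (q i : ℂ)
  have γ_re (w : ℂ) : (fun i => (γ w i).re) =
      b + (((v w).re + w.re) / 2) • p + (((v w).re - w.re) / 2) • q := by
    ext i
    simp [γ]
  have γ_im (w : ℂ) (i : Fin m) : (γ w i).im =
      ((v w).im + w.im) / 2 * p i + ((v w).im - w.im) / 2 * q i := by
    simp [γ]
  have γ_diff : Differentiable ℂ γ := by
    simp only [γ, v]
    fun_prop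
  let Ω : Set ℂ := {w | |w.re| < 1 + η ∧ |w.re| < κ + e * (w.re ^ 2 - w.im ^ 2)}
  have abs_re_cont : Continuous fun w : ℂ => |w.re| := Complex.continuous_re.abs
  have quad_cont : Continuous fun w : ℂ => κ + e * (w.re ^ 2 - w.im ^ 2) := by fun_prop
  have Ω_open : IsOpen Ω :=
    (isOpen_lt abs_re_cont continuous_const).inter (isOpen_lt abs_re_cont quad_cont)
  have closure_Ω : closure Ω ⊆
      {w | |w.re| ≤ 1 + η ∧ |w.re| ≤ κ + e * (w.re ^ 2 - w.im ^ 2)} := by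
    refine closure_minimal (fun w hw => ⟨hw.1.le, hw.2.le⟩) ?_
    exact (isClosed_le abs_re_cont continuous_const).inter (isClosed_le abs_re_cont quad_cont)
  have re_v_le {w : ℂ} (hw : w ∈ closure Ω) : (v w).re ≤ 1 + η / 2 := by
    have h1 := (closure_Ω hw).1
    have h2 : w.re ^ 2 ≤ 4 := by
      rw [← sq_abs]; nlinarith [abs_nonneg w.re]
    rw [v_re]
    nlinarith [sq_nonneg w.im]
  have im_le {w : ℂ} (hw : w ∈ closure Ω) : |w.im| ≤ 16 / η := by
    have h1 := (closure_Ω hw).2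
    have h2 := (closure_Ω hw).1
    have h3 : w.re ^ 2 ≤ 4 := by
      rw [← sq_abs]; nlinarith [abs_nonneg w.re]
    have h4 : e * w.im ^ 2 ≤ 2 := by
      nlinarith [abs_nonneg w.re]
    refine abs_le_of_sq_le_sq ?_ (by positivity)
    have h5 : w.im ^ 2 ≤ 16 / η := by
      rw [le_div_iff₀ hη]; rw [he] at h4; linarith
    have h6 : 1 ≤ 16 / η := by rw [le_div_iff₀ hη]; linarith
    nlinarith
  have norm_im_le {w : ℂ} (hw : w ∈ closure Ω) :
      ‖fun i => (γ w i).im‖ ≤ 16 / η * (‖p‖ + ‖q‖) := by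
    refine (pi_norm_le_iff_of_nonneg hR).2 fun i => ?_
    have h1 : |(v w).im| ≤ |w.im| := by
      rw [v_im, abs_mul, abs_mul, abs_of_pos (by positivity : (0 : ℝ) < 2 * e)]
      have h2 := (closure_Ω hw).1
      have h3 : 2 * e * |w.re| ≤ 1 := by nlinarith [abs_nonneg w.re]
      nlinarith [abs_nonneg w.im]
    have h2 := im_le hw
    have hp : |p i| ≤ ‖p‖ := norm_le_pi_norm p i
    have hq : |q i| ≤ ‖q‖ := norm_le_pi_norm q i
    have h3 : |((v w).im + w.im) / 2| ≤ 16 / η := by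
      have := abs_le.1 (h1.trans h2)
      have := abs_le.1 h2
      exact abs_le.2 ⟨by linarith, by linarith⟩
    have h4 : |((v w).im - w.im) / 2| ≤ 16 / η := by
      have := abs_le.1 (h1.trans h2)
      have := abs_le.1 h2
      exact abs_le.2 ⟨by linarith, by linarith⟩
    rw [γ_im, Real.norm_eq_abs]
    refine (abs_add_le _ _).trans ?_
    rw [abs_mul, abs_mul, mul_add]
    gcongr
  have Ω_bdd : Bornology.IsBounded Ω := by
    refine isBounded_iff_forall_norm_le.2 ⟨(1 + η) + 16 / η, fun w hw => ?_⟩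
    exact (Complex.norm_le_abs_re_add_abs_im w).trans
      (add_le_add hw.1.le (im_le (subset_closure hw)))
  have g_diff : DifferentiableOn ℂ (fun w => g (γ w)) (closure Ω) := by
    refine hg.comp γ_diff.differentiableOn fun w hw => ?_
    have h1 := abs_le.1 (v_re w ▸ (closure_Ω hw).2)
    have h2 := re_v_le hw
    change (fun i => (γ w i).re) ∈ D
    rw [γ_re]
    exact hD _ _ (by linarith) (by linarith) (by linarith)
  have bound : ∀ w ∈ frontier Ω, ‖g (γ w)‖ ≤ M := by
    intro w hw
    have hwc : w ∈ closure Ω := frontier_subset_closure hw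
    have hwn : w ∉ Ω := by
      rw [Ω_open.frontier_eq] at hw; exact hw.2
    have h2 := re_v_le hwc
    have h3 := closure_Ω hwc
    have h4 : |w.re| = (v w).re := by
      rw [v_re] at h2 ⊢
      refine le_antisymm h3.2 (not_lt.1 fun h => hwn ⟨?_, h⟩)
      linarith
    have h5 : 0 ≤ (v w).re := h4 ▸ abs_nonneg _
    have h6 := hM (fun i => (γ w i).re) ?_ (fun i => (γ w i).im) (norm_im_le hwc)
    · simpa only [Complex.re_add_im] using h6
    · rw [γ_re]
      rcases abs_choice w.re with h | h
      · refine Or.inl ⟨(v w).re, ⟨h5, by linarith⟩, ?_⟩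
        have : w.re = (v w).re := by rw [← h4, h]
        simp [this]
      · refine Or.inr ⟨(v w).re, ⟨h5, by linarith⟩, ?_⟩
        have : w.re = -(v w).re := by rw [← h4, h, neg_neg]
        simp [this]
  have mem : ((s - t : ℝ) : ℂ) ∈ Ω := by
    have h1 : |s - t| < s + t := abs_lt.2 ⟨by linarith, by linarith⟩
    constructor
    · rw [Complex.ofReal_re]; linarith
    · rw [Complex.ofReal_re, Complex.ofReal_im, hκ]; linarith
  have key := Complex.norm_le_of_forall_mem_frontier_norm_le Ω_bdd g_diff.diffContOnCl bound
    (subset_closure mem)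
  have hpt : γ ((s - t : ℝ) : ℂ) = fun i => ((b + s • p + t • q) i : ℂ) := by
    ext i
    have : v ((s - t : ℝ) : ℂ) = ((s + t : ℝ) : ℂ) := by
      simp only [v, hκ]; push_cast; ring
    simp only [γ, this, Pi.add_apply, Pi.smul_apply, smul_eq_mul]
    push_cast; ring
  simpa only [hpt] using key

/-- The points of `D` near which all points are controlled by a common compact subset of `U`. -/
def tubeHull {m : ℕ} (D U : Set (Fin m → ℝ)) : Set (Fin m → ℝ) :=
  {x | x ∈ D ∧ ∃ K ⊆ U, IsCompact K ∧ ∃ R : ℝ, ∀ᶠ x' in nhds x, TubeControlled D K R x'}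

theorem subset_tubeHull {m : ℕ} {D U : Set (Fin m → ℝ)} (hU : IsOpen U) (hUD : U ⊆ D) :
    U ⊆ tubeHull D U := by
  intro x hx
  obtain ⟨K, hK, hxK, hKU⟩ := exists_compact_subset hU hx
  refine ⟨hUD hx, K, hKU, hK, 0, ?_⟩
  filter_upwards [mem_interior_iff_mem_nhds.1 hxK] with x' hx'
  exact .of_mem le_rfl hx'

theorem IsCompact.exists_tubeControlled {m : ℕ} {D U L : Set (Fin m → ℝ)} (hL : IsCompact L)
    (hLU : L ⊆ tubeHull D U) :
    ∃ K ⊆ U, IsCompact K ∧ ∃ R : ℝ, ∃ O, IsOpen O ∧ L ⊆ O ∧ ∀ x ∈ O, TubeControlled D K R x := by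
  refine hL.induction_on (p := fun L => ∃ K ⊆ U, IsCompact K ∧ ∃ R : ℝ, ∃ O, IsOpen O ∧ L ⊆ O ∧
    ∀ x ∈ O, TubeControlled D K R x) ?_ ?_ ?_ ?_
  · exact ⟨∅, Set.empty_subset _, isCompact_empty, 0, ∅, isOpen_empty, le_rfl, by simp⟩
  · rintro L₁ L₂ h ⟨K, hKU, hK, R, O, hO, hLO, h'⟩
    exact ⟨K, hKU, hK, R, O, hO, h.trans hLO, h'⟩
  · rintro L₁ L₂ ⟨K, hKU, hK, R, O, hO, hLO, h⟩ ⟨K', hKU', hK', R', O', hO', hLO', h'⟩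
    refine ⟨K ∪ K', Set.union_subset hKU hKU', hK.union hK', max R R', O ∪ O', hO.union hO',
      Set.union_subset_union hLO hLO', ?_⟩
    rintro x (hx | hx)
    · exact (h x hx).mono Set.subset_union_left (le_max_left _ _)
    · exact (h' x hx).mono Set.subset_union_right (le_max_right _ _)
  · intro x hx
    obtain ⟨-, K, hKU, hK, R, h⟩ := hLU hx
    obtain ⟨O, hO, hO', hxO⟩ := eventually_nhds_iff.1 h
    exact ⟨O, mem_nhdsWithin_of_mem_nhds (hO'.mem_nhds hxO), K, hKU, hK, R, O, hO', le_rfl, hO⟩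

theorem triangle_subset_tubeHull {m : ℕ} {D U : Set (Fin m → ℝ)} (hDo : IsOpen D)
    (hD : Convex ℝ D) {b p q : Fin m → ℝ}
    (hp : ∀ r ∈ Set.Icc (0 : ℝ) 1, b + r • p ∈ tubeHull D U)
    (hq : ∀ r ∈ Set.Icc (0 : ℝ) 1, b + r • q ∈ tubeHull D U)
    {s t : ℝ} (hs : 0 ≤ s) (ht : 0 ≤ t) (hst : s + t ≤ 1) :
    b + s • p + t • q ∈ tubeHull D U := by
  let L : Set (Fin m → ℝ) :=
    (fun r : ℝ => b + r • p) '' Set.Icc 0 1 ∪ (fun r : ℝ => b + r • q) '' Set.Icc 0 1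
  have hL : IsCompact L :=
    (isCompact_Icc.image (by fun_prop)).union (isCompact_Icc.image (by fun_prop))
  have hLU : L ⊆ tubeHull D U := by
    rintro _ (⟨r, hr, rfl⟩ | ⟨r, hr, rfl⟩)
    exacts [hp r hr, hq r hr]
  obtain ⟨K, hKU, hK, R, O, hO, hLO, hctl⟩ := hL.exists_tubeControlled hLU
  obtain ⟨δ, hδ, hthick⟩ := hL.exists_thickening_subset_open (hO.inter hDo)
    (Set.subset_inter hLO fun x hx => (hLU hx).1)
  obtain ⟨η, hη, hη1, hηδ⟩ : ∃ η : ℝ, 0 < η ∧ η ≤ 1 ∧ η * (‖p‖ + ‖q‖) < δ / 2 := by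
    refine ⟨min 1 (δ / 4 / (‖p‖ + ‖q‖ + 1)), by positivity, min_le_left _ _, ?_⟩
    calc min 1 (δ / 4 / (‖p‖ + ‖q‖ + 1)) * (‖p‖ + ‖q‖)
        ≤ δ / 4 / (‖p‖ + ‖q‖ + 1) * (‖p‖ + ‖q‖ + 1) := by
          refine mul_le_mul (min_le_right _ _) (by linarith) (by positivity) (by positivity)
      _ = δ / 4 := by field_simp
      _ < δ / 2 := by linarith
  have near (h : Fin m → ℝ) (hh : ‖h‖ < δ / 2) (a : Fin m → ℝ) (ha : η * ‖a‖ < δ / 2)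
      (haL : ∀ r ∈ Set.Icc (0 : ℝ) 1, b + r • a ∈ L) :
      ∀ r ∈ Set.Icc 0 (1 + η), b + h + r • a ∈ O ∩ D := by
    intro r hr
    refine hthick (Metric.mem_thickening_iff.2 ⟨_, haL (r / (1 + η)) ⟨?_, ?_⟩, ?_⟩)
    · exact div_nonneg hr.1 (by linarith)
    · exact (div_le_one (by linarith)).2 hr.2
    · have h1 : b + h + r • a - (b + (r / (1 + η)) • a) = h + (r / (1 + η) * η) • a := by
        ext i
        simp only [Pi.add_apply, Pi.sub_apply, Pi.smul_apply, smul_eq_mul]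
        field_simp
        ring
      have h2 : r / (1 + η) ≤ 1 := (div_le_one (by linarith)).2 hr.2
      have h3 : 0 ≤ r / (1 + η) := div_nonneg hr.1 (by linarith)
      rw [dist_eq_norm, h1]
      refine (norm_add_le _ _).trans_lt ?_
      rw [norm_smul, Real.norm_of_nonneg (by positivity)]
      have h4 : r / (1 + η) * η * ‖a‖ ≤ η * ‖a‖ := by
        rw [mul_assoc]
        exact mul_le_of_le_one_left (by positivity) h2
      linarith
  have hpη : η * ‖p‖ < δ / 2 := by nlinarith [norm_nonneg q]
  have hqη : η * ‖q‖ < δ / 2 := by nlinarith [norm_nonneg p]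
  refine ⟨?_, K, hKU, hK, 16 / η * (‖p‖ + ‖q‖) + R, ?_⟩
  · have h0 := (hp 0 (by simp)).1
    have h1 := (hp 1 (by simp)).1
    have h2 := (hq 1 (by simp)).1
    have := hD.sum_mem (t := Finset.univ) (w := ![1 - s - t, s, t])
      (z := ![b + (0 : ℝ) • p, b + (1 : ℝ) • p, b + (1 : ℝ) • q])
      (by intro i _; fin_cases i <;> simp <;> linarith)
      (by simp [Fin.sum_univ_three]; ring)
      (by intro i _; fin_cases i <;> assumption)
    convert this using 1
    ext i
    simp [Fin.sum_univ_three]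
    ring
  · filter_upwards [Metric.ball_mem_nhds (b + s • p + t • q) (half_pos hδ)] with x hx
    obtain ⟨h, rfl⟩ : ∃ h, x = (b + h) + s • p + t • q :=
      ⟨x - (b + s • p + t • q), by module⟩
    have hh : ‖h‖ < δ / 2 := by
      rw [Metric.mem_ball, dist_eq_norm] at hx
      have : b + h + s • p + t • q - (b + s • p + t • q) = h := by module
      rwa [this] at hx
    have np := near h hh p hpη fun r hr => Or.inl ⟨r, hr, rfl⟩
    have nq := near h hh q hqη fun r hr => Or.inr ⟨r, hr, rfl⟩
    refine (tubeControlled_triangle (b + h) p q hη hη1 ?_ hs ht hst).trans (K := K) (R₂ := R) ?_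
    · intro s t hs ht hst
      have h0 := (np 0 ⟨le_rfl, by linarith⟩).2
      have h1 := (np (1 + η) ⟨by linarith, le_rfl⟩).2
      have h2 := (nq (1 + η) ⟨by linarith, le_rfl⟩).2
      have hη' : 0 < 1 + η := by linarith
      have := hD.sum_mem (t := Finset.univ)
        (w := ![1 - (s + t) / (1 + η), s / (1 + η), t / (1 + η)])
        (z := ![b + h + (0 : ℝ) • p, b + h + (1 + η) • p, b + h + (1 + η) • q])
        (by
          intro i _
          fin_cases i
          · simpa using (div_le_one hη').2 hst
          · exact div_nonneg hs hη'.le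
          · exact div_nonneg ht hη'.le)
        (by simp [Fin.sum_univ_three]; ring)
        (by intro i _; fin_cases i <;> assumption)
      convert this using 1
      ext i
      simp [Fin.sum_univ_three]
      field_simp
      ring
    · rintro _ (⟨r, hr, rfl⟩ | ⟨r, hr, rfl⟩)
      exacts [hctl _ (np r hr).1, hctl _ (nq r hr).1]

theorem segment_subset_tubeHull_of_triangle {m : ℕ} {D U : Set (Fin m → ℝ)} (hDo : IsOpen D)
    (hD : Convex ℝ D) {a b c : Fin m → ℝ} (hab : segment ℝ b a ⊆ tubeHull D U)
    (hbc : segment ℝ b c ⊆ tubeHull D U) {x : Fin m → ℝ} (hx : x ∈ segment ℝ a c) :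
    segment ℝ b x ⊆ tubeHull D U := by
  rw [segment_eq_image'] at hab hbc hx ⊢
  obtain ⟨r, hr, rfl⟩ := hx
  rintro _ ⟨k, hk, rfl⟩
  have := triangle_subset_tubeHull hDo hD (b := b) (p := a - b) (q := c - b)
    (fun r hr => hab ⟨r, hr, rfl⟩) (fun r hr => hbc ⟨r, hr, rfl⟩)
    (s := k * (1 - r)) (t := k * r) (mul_nonneg hk.1 (by linarith [hr.2]))
    (mul_nonneg hk.1 hr.1) (by linarith [hk.2])
  convert this using 1
  ext i
  simp
  ring

theorem convexHull_subset_tubeHull {m : ℕ} {U : Set (Fin m → ℝ)} (hU : IsOpen U)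
    (hUc : IsConnected U) : convexHull ℝ U ⊆ tubeHull (convexHull ℝ U) U := by
  have hDo : IsOpen (convexHull ℝ U) := hU.convexHull
  have hD : Convex ℝ (convexHull ℝ U) := convex_convexHull ℝ U
  have hUV := subset_tubeHull hU (subset_convexHull ℝ U)
  have trans' {a b c : Fin m → ℝ} (hab : segment ℝ a b ⊆ tubeHull (convexHull ℝ U) U)
      (hbc : segment ℝ b c ⊆ tubeHull (convexHull ℝ U) U) :
      segment ℝ a c ⊆ tubeHull (convexHull ℝ U) U := by
    intro x hx
    rw [segment_symm] at hab
    exact segment_subset_tubeHull_of_triangle hDo hD hab hbc hx (right_mem_segment ℝ b x)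
  have hseg : ∀ a ∈ U, ∀ b ∈ U, segment ℝ a b ⊆ tubeHull (convexHull ℝ U) U := by
    intro a ha b hb
    refine hUc.isPreconnected.induction₂
      (fun a b => segment ℝ a b ⊆ tubeHull (convexHull ℝ U) U) ?_ ?_ ?_ ha hb
    · intro x hx
      obtain ⟨r, hr, hball⟩ := Metric.isOpen_iff.1 hU x hx
      filter_upwards [mem_nhdsWithin_of_mem_nhds (Metric.ball_mem_nhds x hr)] with y hy
      exact (((convex_ball x r).segment_subset (Metric.mem_ball_self hr) hy).trans hball).trans hUV
    · intro x y z _ _ _ hxy hyz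
      exact trans' hxy hyz
    · intro x y _ _ hxy
      rwa [segment_symm]
  obtain ⟨a, ha⟩ := hUc.nonempty
  have hconv : Convex ℝ {b | segment ℝ a b ⊆ tubeHull (convexHull ℝ U) U} := by
    rw [convex_iff_segment_subset]
    intro x hx y hy z hz
    exact segment_subset_tubeHull_of_triangle hDo hD hx hy hz
  intro x hx
  exact convexHull_min (fun b hb => hseg a ha b hb) hconv hx (right_mem_segment ℝ a x)

theorem euclNorm2_nonneg {d e : ℕ} (t : (Fin d → ℝ) × (Fin e → ℝ)) : 0 ≤ euclNorm2 t :=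
  Real.sqrt_nonneg _

theorem one_add_euclNorm2_add_le {d e : ℕ} (t : (Fin d → ℝ) × (Fin e → ℝ)) (y : Fin e → ℝ)
    {R : ℝ} (hy : ‖y‖ ≤ R) :
    1 + euclNorm2 (t.1, y + t.2) ≤ (2 + 2 * (e + 1) * R) * (1 + euclNorm2 t) := by
  have hN := euclNorm2_nonneg t
  have hR : 0 ≤ R := (norm_nonneg y).trans hy
  have hsq : euclNorm2 t ^ 2 = ∑ j, t.1 j ^ 2 + ∑ i, t.2 i ^ 2 := Real.sq_sqrt (by positivity)
  have h1 : ∑ i, (y i + t.2 i) ^ 2 ≤ 2 * (e * R ^ 2) + 2 * ∑ i, t.2 i ^ 2 := by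
    have : ∑ i, (y i + t.2 i) ^ 2 ≤ ∑ i, (2 * R ^ 2 + 2 * t.2 i ^ 2) := by
      refine Finset.sum_le_sum fun i _ => ?_
      have h2 : |y i| ≤ R := (norm_le_pi_norm y i).trans hy
      have h3 : y i ^ 2 ≤ R ^ 2 := sq_le_sq' (by linarith [(abs_le.1 h2).1]) (abs_le.1 h2).2
      nlinarith [sq_nonneg (y i - t.2 i)]
    refine this.trans (le_of_eq ?_)
    rw [Finset.sum_add_distrib, Finset.sum_const, Finset.card_univ, Fintype.card_fin,
      nsmul_eq_mul, ← Finset.mul_sum]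
    ring
  have h2 : euclNorm2 (t.1, y + t.2) ≤ 2 * euclNorm2 t + 2 * (e + 1) * R := by
    refine Real.sqrt_le_iff.2 ⟨by positivity, ?_⟩
    have h3 : 0 ≤ ∑ j, t.1 j ^ 2 := by positivity
    have h4 : 0 ≤ (e : ℝ) * R ^ 2 := by positivity
    have h5 : 0 ≤ (e : ℝ) ^ 2 * R ^ 2 := by positivity
    have h6 : 0 ≤ euclNorm2 t * ((e + 1) * R) := by positivity
    simp only [Pi.add_apply]
    nlinarith [sq_nonneg R, sq_nonneg (euclNorm2 t)]
  have h3 : 0 ≤ 2 * (e + 1) * R * euclNorm2 t := by positivity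
  nlinarith

/-- Multivariable Phragmén–Lindelöf with independent variables: suppose `f` is holomorphic
on the tube over `W × convexHull(U′)` where `W = {x ∈ ℝ^d : x_j > c_j}` and
`U′ ⊆ ℝ^(n-d)` is open and connected, and `μ : ℝ^d → [0,∞)` is continuous and
non-increasing in each coordinate. If for every `ε > 0`, `f` satisfies the bound
`|f(σ + it)| ≤ C (1 + ‖t‖)^(μ(σ₁,…,σ_d)+ε)` locally uniformly on the tube over `W × U′`,
then the same bound (with new constants) holds locally uniformly on the tube over
`W × convexHull(U′)`. -/
theorem multivariable_phragmen_lindelof_indep (n d : ℕ) (hn : 1 ≤ n) (hdn : d ≤ n)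
    (c : Fin d → ℝ)
    (U' : Set (Fin (n - d) → ℝ)) (hU'open : IsOpen U') (hU'conn : IsConnected U')
    (μ : (Fin d → ℝ) → ℝ) (hμ0 : ∀ x, 0 ≤ μ x) (hμcont : Continuous μ)
    (hμmono : ∀ x y : Fin d → ℝ, (∀ j, x j ≤ y j) → μ y ≤ μ x)
    (f : (Fin d → ℂ) × (Fin (n - d) → ℂ) → ℂ)
    (hf : DifferentiableOn ℂ f
      {p : (Fin d → ℂ) × (Fin (n - d) → ℂ) |
        (∀ j, c j < (p.1 j).re) ∧ (fun i => (p.2 i).re) ∈ convexHull ℝ U'})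
    (hbound : ∀ ε : ℝ, 0 < ε → ∀ Q : Set ((Fin d → ℝ) × (Fin (n - d) → ℝ)),
      IsCompact Q → Q ⊆ {σ | (∀ j, c j < σ.1 j) ∧ σ.2 ∈ U'} →
      ∃ C : ℝ, ∀ σ ∈ Q, ∀ t : (Fin d → ℝ) × (Fin (n - d) → ℝ),
        ‖f (fun j => (σ.1 j : ℂ) + (t.1 j : ℂ) * Complex.I,
            fun i => (σ.2 i : ℂ) + (t.2 i : ℂ) * Complex.I)‖ ≤
          C * (1 + euclNorm2 t) ^ (μ σ.1 + ε)) :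
    ∀ ε : ℝ, 0 < ε → ∀ Q' : Set ((Fin d → ℝ) × (Fin (n - d) → ℝ)),
      IsCompact Q' → Q' ⊆ {σ | (∀ j, c j < σ.1 j) ∧ σ.2 ∈ convexHull ℝ U'} →
      ∃ C' : ℝ, ∀ σ ∈ Q', ∀ t : (Fin d → ℝ) × (Fin (n - d) → ℝ),
        ‖f (fun j => (σ.1 j : ℂ) + (t.1 j : ℂ) * Complex.I,
            fun i => (σ.2 i : ℂ) + (t.2 i : ℂ) * Complex.I)‖ ≤
          C' * (1 + euclNorm2 t) ^ (μ σ.1 + ε) := by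
  intro ε hε Q' hQ' hQ'sub
  obtain ⟨K, hKU, hK, R, O, -, hKO, hctl⟩ := (hQ'.image continuous_snd).exists_tubeControlled
    (Set.image_subset_iff.2 fun σ hσ =>
      convexHull_subset_tubeHull hU'open hU'conn (hQ'sub hσ).2)
  have hK₁ : IsCompact (Prod.fst '' Q') := hQ'.image continuous_fst
  obtain ⟨C, hC⟩ := hbound ε hε ((Prod.fst '' Q') ×ˢ K) (hK₁.prod hK) (by
    rintro ⟨_, x⟩ ⟨⟨σ, hσ, rfl⟩, hx⟩
    exact ⟨(hQ'sub hσ).1, hKU hx⟩)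
  obtain ⟨B, hB⟩ := (hK₁.image hμcont).bddAbove
  obtain ⟨A, hA⟩ : ∃ A : ℝ, A = 2 + 2 * ((n - d : ℕ) + 1) * max R 0 := ⟨_, rfl⟩
  have hA1 : 1 ≤ A := by
    have : 0 ≤ 2 * (((n - d : ℕ) : ℝ) + 1) * max R 0 := by positivity
    linarith
  refine ⟨max C 0 * A ^ (B + ε), fun σ hσ t => ?_⟩
  have hσμ : μ σ.1 ≤ B := hB ⟨σ.1, ⟨σ, hσ, rfl⟩, rfl⟩
  have hexp : 0 ≤ μ σ.1 + ε := add_nonneg (hμ0 _) hε.le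
  have hN := euclNorm2_nonneg t
  have hg : DifferentiableOn ℂ (fun z : Fin (n - d) → ℂ =>
      f (fun j => (σ.1 j : ℂ) + (t.1 j : ℂ) * Complex.I, z))
      {z | (fun i => (z i).re) ∈ convexHull ℝ U'} := by
    refine hf.comp (f := fun z : Fin (n - d) → ℂ =>
      ((fun j => (σ.1 j : ℂ) + (t.1 j : ℂ) * Complex.I : Fin d → ℂ), z)) ?_ ?_
    · refine Differentiable.differentiableOn ?_
      fun_prop
    · intro z hz
      exact ⟨by simpa using (hQ'sub hσ).1, hz⟩
  refine hctl σ.2 (hKO ⟨σ, hσ, rfl⟩) _ (differentiableOn_tube_add_im hg t.2) _ fun x hx y hy => ?_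
  have h1 := hC (σ.1, x) ⟨⟨σ, hσ, rfl⟩, hx⟩ (t.1, y + t.2)
  have h2 := one_add_euclNorm2_add_le t y (hy.trans (le_max_left R 0))
  rw [← hA] at h2
  have h3 := euclNorm2_nonneg (t.1, y + t.2)
  calc _ ≤ C * (1 + euclNorm2 (t.1, y + t.2)) ^ (μ σ.1 + ε) := by
        simpa [add_mul, add_assoc] using h1
    _ ≤ max C 0 * (A * (1 + euclNorm2 t)) ^ (μ σ.1 + ε) := by
        gcongr
        exact le_max_left _ _
    _ = max C 0 * (A ^ (μ σ.1 + ε) * (1 + euclNorm2 t) ^ (μ σ.1 + ε)) := by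
        rw [Real.mul_rpow (by linarith) (by linarith)]
    _ ≤ max C 0 * (A ^ (B + ε) * (1 + euclNorm2 t) ^ (μ σ.1 + ε)) := by
        gcongr
    _ = max C 0 * A ^ (B + ε) * (1 + euclNorm2 t) ^ (μ σ.1 + ε) := by ring
end

section
/- Let 0 < γ < 1 and n ≥ 1, and for each j = 1, …, n define U_j = {x ∈ ℝⁿ : x_j > γ and x_k > 1 for every k ≠ j}. Then the convex hull of U_1 ∪ ⋯ ∪ U_n contains the set {x ∈ ℝⁿ : x_j > 1 − (1−γ)/n for every j}. -/
/-- For `0 < γ < 1` and `U_j = {x ∈ ℝⁿ : x_j > γ, x_k > 1 for k ≠ j}`, the convex hull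
of `U_1 ∪ ⋯ ∪ U_n` contains `{x ∈ ℝⁿ : x_j > 1 - (1-γ)/n for all j}`. -/
theorem convexHull_union_orthants (n : ℕ) (hn : 1 ≤ n) (γ : ℝ) (hγ0 : 0 < γ)
    (hγ1 : γ < 1) :
    {x : Fin n → ℝ | ∀ j, 1 - (1 - γ) / (n : ℝ) < x j} ⊆
      convexHull ℝ
        (⋃ j : Fin n, {x : Fin n → ℝ | γ < x j ∧ ∀ k, k ≠ j → 1 < x k}) := by
  intro x hx
  have hn0 : (n : ℝ) ≠ 0 := by positivity
  -- `x` is the barycenter of the points `p j ∈ U_j`.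
  let p : Fin n → Fin n → ℝ := fun j k =>
    x k + (1 - γ) / n - if k = j then 1 - γ else 0
  have hp : x = ∑ j : Fin n, (1 / n : ℝ) • p j := by
    ext k
    simp only [p, Finset.sum_apply, Pi.smul_apply, smul_eq_mul, ← Finset.mul_sum,
      Finset.sum_sub_distrib, Finset.sum_const, Finset.sum_ite_eq, Finset.mem_univ,
      if_true, Finset.card_univ, Fintype.card_fin, nsmul_eq_mul]
    field_simp
    ring
  rw [hp]
  refine (convex_convexHull ℝ _).sum_mem (fun _ _ => by positivity) (by simp [hn0]) ?_
  refine fun j _ => subset_convexHull ℝ _ (Set.mem_iUnion.2 ⟨j, ?_, fun k hk => ?_⟩)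
  · have := hx j
    simp only [p, if_true]
    linarith
  · have := hx k
    simp only [p, if_neg hk]
    linarith
end

section
/- Let A, B ≥ 0 be real numbers with A·B < 1, and let δ > 0. For ε > 0 define V₁(ε) = {(x, y) ∈ ℝ² : x > 1−δ, y > 1+ε, and y + A·x > 1 + A} and V₂(ε) = {(x, y) ∈ ℝ² : x > 1+ε, y > 1−δ, and x + B·y > 1 + B}. Then there exists ε₀ > 0 such that for all ε with 0 < ε < ε₀, the point (1, 1) lies in the convex hull of V₁(ε) ∪ V₂(ε). -/
/-- A two-dimensional convex hull computation: if `A, B ≥ 0` with `A·B < 1` and `δ > 0`,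
then for all sufficiently small `ε > 0` the point `(1,1)` lies in the convex hull of
`V₁(ε) ∪ V₂(ε)`, where `V₁(ε) = {x > 1-δ, y > 1+ε, y + A·x > 1 + A}` and
`V₂(ε) = {x > 1+ε, y > 1-δ, x + B·y > 1 + B}`. -/
theorem convexHull_two_regions (A B δ : ℝ) (hA : 0 ≤ A) (hB : 0 ≤ B)
    (hAB : A * B < 1) (hδ : 0 < δ) :
    ∃ ε₀ : ℝ, 0 < ε₀ ∧ ∀ ε : ℝ, 0 < ε → ε < ε₀ →
      ((1, 1) : ℝ × ℝ) ∈ convexHull ℝ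
        ({p : ℝ × ℝ | 1 - δ < p.1 ∧ 1 + ε < p.2 ∧ 1 + A < p.2 + A * p.1} ∪
          {p : ℝ × ℝ | 1 + ε < p.1 ∧ 1 - δ < p.2 ∧ 1 + B < p.1 + B * p.2}) := by
  obtain ⟨a, hAa, haB⟩ : ∃ a : ℝ, A < a ∧ a * B < 1 := by
    have hB1 : 0 < B + 1 := by linarith
    have hc : 0 < (1 - A * B) / (B + 1) := div_pos (by linarith) hB1
    have hc' : (1 - A * B) / (B + 1) * (B + 1) = 1 - A * B := div_mul_cancel₀ _ hB1.ne'
    exact ⟨A + (1 - A * B) / (B + 1), by linarith, by linarith⟩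
  have ha : 0 < a := hA.trans_lt hAa
  obtain ⟨t, ht, htδ, hatδ⟩ : ∃ t : ℝ, 0 < t ∧ t < δ ∧ a * t < δ := by
    have ht : 0 < δ / (1 + a) / 2 := by positivity
    have h : δ / (1 + a) * (1 + a) = δ := div_mul_cancel₀ _ (by positivity)
    have hat := mul_pos ha ht
    exact ⟨δ / (1 + a) / 2, ht, by linarith, by linarith⟩
  have hat : 0 < a * t := mul_pos ha ht
  refine ⟨min t (a * t), lt_min ht hat, fun ε _ hε => ?_⟩
  obtain ⟨hεt, hεat⟩ := lt_min_iff.mp hε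
  have hAt : A * t < a * t := mul_lt_mul_of_pos_right hAa ht
  have hBt : a * B * t < 1 * t := mul_lt_mul_of_pos_right haB ht
  have hmid : ((1, 1) : ℝ × ℝ) =
      (1 / 2 : ℝ) • ((1 - t, 1 + a * t) : ℝ × ℝ) +
        (1 / 2 : ℝ) • ((1 + t, 1 - a * t) : ℝ × ℝ) := by
    ext <;> simp <;> ring
  rw [hmid]
  apply convex_convexHull ℝ _ _ _ (by norm_num) (by norm_num) (by norm_num)
  · refine subset_convexHull ℝ _ (Or.inl ⟨?_, ?_, ?_⟩) <;> dsimp only <;> linarith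
  · refine subset_convexHull ℝ _ (Or.inr ⟨?_, ?_, ?_⟩) <;> dsimp only <;> linarith
end

section
/- In ℝ³, define U_B = {(x,y,z) : x > 1/2, y > 1, z > 1, y + (3/8)x > 11/8, z + (3/8)x > 11/8}, U_C = {(x,y,z) : y > 1/2, x > 1, z > 1, x + (3/8)y > 11/8, z + (3/8)y > 11/8}, and U_D = {(x,y,z) : z > 1/2, x > 1, y > 1, x + (3/8)z > 11/8, y + (3/8)z > 11/8}. Then the convex hull of U_B ∪ U_C ∪ U_D contains the set {(x,y,z) : x > 1/2, y > 1/2, z > 1/2, x + y > 27/16, x + z > 27/16, y + z > 27/16, and x + y + z > 23/8}. -/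
/-- A convex combination of three points of a set lies in its convex hull. -/
theorem convexCombination_three_mem_convexHull {E : Type*} [AddCommGroup E] [Module ℝ E]
    {s : Set E} {u v w : E} (hu : u ∈ s) (hv : v ∈ s) (hw : w ∈ s) {a b c : ℝ}
    (ha : 0 ≤ a) (hb : 0 ≤ b) (hc : 0 ≤ c) (habc : a + b + c = 1) :
    a • u + b • v + c • w ∈ convexHull ℝ s := by
  have h := (convex_convexHull ℝ s).sum_mem (t := Finset.univ) (w := ![a, b, c])
    (z := ![u, v, w])
    (by simp [Fin.forall_fin_succ, ha, hb, hc])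
    (by simpa [Fin.sum_univ_three] using habc)
    (by simp [Fin.forall_fin_succ, subset_convexHull ℝ s hu, subset_convexHull ℝ s hv,
      subset_convexHull ℝ s hw])
  simpa [Fin.sum_univ_three] using h

/-- The region is the open positive orthant translated along the triangle with vertices
`(1/2, 19/16, 19/16)`, `(19/16, 1/2, 19/16)`, `(19/16, 19/16, 1/2)`: some point of this triangle,
with barycentric coordinates `a, b, c`, is strictly below `(x, y, z)` in every coordinate. -/
theorem exists_triangle_point_lt {x y z : ℝ} (hx : 1 / 2 < x) (hy : 1 / 2 < y) (hz : 1 / 2 < z)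
    (hxy : 27 / 16 < x + y) (hxz : 27 / 16 < x + z) (hyz : 27 / 16 < y + z)
    (hxyz : 23 / 8 < x + y + z) :
    ∃ a b c : ℝ, 0 ≤ a ∧ 0 ≤ b ∧ 0 ≤ c ∧ a + b + c = 1 ∧
      19 / 16 - 11 / 16 * a < x ∧ 19 / 16 - 11 / 16 * b < y ∧ 19 / 16 - 11 / 16 * c < z := by
  let l : ℝ → ℝ := fun t => max 0 ((19 - 16 * t) / 11)
  have l_nonneg (t : ℝ) : 0 ≤ l t := le_max_left _ _
  have le_l (t : ℝ) : (19 - 16 * t) / 11 ≤ l t := le_max_right _ _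
  have hl : l x + l y + l z < 1 := by
    rcases max_choice 0 ((19 - 16 * x) / 11) with h₁ | h₁ <;>
    rcases max_choice 0 ((19 - 16 * y) / 11) with h₂ | h₂ <;>
    rcases max_choice 0 ((19 - 16 * z) / 11) with h₃ | h₃ <;>
    simp only [l, h₁, h₂, h₃] <;> linarith
  refine ⟨l x + (1 - (l x + l y + l z)) / 3, l y + (1 - (l x + l y + l z)) / 3,
    l z + (1 - (l x + l y + l z)) / 3, ?_, ?_, ?_, by ring, ?_, ?_, ?_⟩ <;>
  linarith [l_nonneg x, l_nonneg y, l_nonneg z, le_l x, le_l y, le_l z]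


/-- The three-dimensional convex hull computation for the group `16T11`: the convex hull
of `U_B ∪ U_C ∪ U_D` contains the region cut out by `x, y, z > 1/2`,
`x + y, x + z, y + z > 27/16` and `x + y + z > 23/8`. -/
theorem convexHull_16T11 :
    {p : ℝ × ℝ × ℝ |
        1 / 2 < p.1 ∧ 1 / 2 < p.2.1 ∧ 1 / 2 < p.2.2 ∧
        27 / 16 < p.1 + p.2.1 ∧ 27 / 16 < p.1 + p.2.2 ∧ 27 / 16 < p.2.1 + p.2.2 ∧
        23 / 8 < p.1 + p.2.1 + p.2.2} ⊆
      convexHull ℝ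
        ({p : ℝ × ℝ × ℝ | 1 / 2 < p.1 ∧ 1 < p.2.1 ∧ 1 < p.2.2 ∧
            11 / 8 < p.2.1 + 3 / 8 * p.1 ∧ 11 / 8 < p.2.2 + 3 / 8 * p.1} ∪
          {p : ℝ × ℝ × ℝ | 1 / 2 < p.2.1 ∧ 1 < p.1 ∧ 1 < p.2.2 ∧
            11 / 8 < p.1 + 3 / 8 * p.2.1 ∧ 11 / 8 < p.2.2 + 3 / 8 * p.2.1} ∪
          {p : ℝ × ℝ × ℝ | 1 / 2 < p.2.2 ∧ 1 < p.1 ∧ 1 < p.2.1 ∧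
            11 / 8 < p.1 + 3 / 8 * p.2.2 ∧ 11 / 8 < p.2.1 + 3 / 8 * p.2.2}) := by
  rintro ⟨x, y, z⟩ ⟨hx, hy, hz, hxy, hxz, hyz, hxyz⟩
  obtain ⟨a, b, c, ha, hb, hc, habc, hax, hby, hcz⟩ :=
    exists_triangle_point_lt hx hy hz hxy hxz hyz hxyz
  have hp : ((x, y, z) : ℝ × ℝ × ℝ) =
      a • (x + 11 / 16 * a - 11 / 16, y + 11 / 16 * b, z + 11 / 16 * c) +
      b • (x + 11 / 16 * a, y + 11 / 16 * b - 11 / 16, z + 11 / 16 * c) +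
      c • (x + 11 / 16 * a, y + 11 / 16 * b, z + 11 / 16 * c - 11 / 16) := by
    ext <;> simp only [Prod.smul_mk, Prod.mk_add_mk, smul_eq_mul]
    · linear_combination -(x + 11 / 16 * a) * habc
    · linear_combination -(y + 11 / 16 * b) * habc
    · linear_combination -(z + 11 / 16 * c) * habc
  rw [hp]
  refine convexCombination_three_mem_convexHull ?_ ?_ ?_ ha hb hc habc
  · refine Or.inl (Or.inl ⟨?_, ?_, ?_, ?_, ?_⟩) <;> dsimp only <;> linarith
  · refine Or.inl (Or.inr ⟨?_, ?_, ?_, ?_, ?_⟩) <;> dsimp only <;> linarith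
  · refine Or.inr ⟨?_, ?_, ?_, ?_, ?_⟩ <;> dsimp only <;> linarith
end
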